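/- Let μ ∈ ℝ, Z₁ ∈ S², and c₀ ∈ (−1,1). For q ∈ S² with ⟨q,Z₁⟩ = c₀, let n(q) = (Z₁ − c₀ q)/√(1−c₀²) (the unit vector tangent to S² at q, orthogonal to the wall circle). Let τ₀ < τ₁ < ⋯ < τ_N and let q : [τ₀, τ_N] → S² be continuous with ⟨q,Z₁⟩ ≠ ±1 throughout, C² on each closed subinterval [τ_{i−1}, τ_i] where it solves the spherical Kepler–Coulomb ODE with mass factor μ and center Z₁, and at each interior node τ_i: ⟨q(τ_i),Z₁⟩ = c₀ and the one-sided velocities satisfy v⁺ = v⁻ − 2⟨v⁻, n(q(τ_i))⟩ n(q(τ_i)). Then both the spherical energy E(q,v) = ½|v|² − μ⟨q,Z₁⟩(1−⟨q,Z₁⟩²)^{−1/2} and the axial angular momentum ⟨q × v, Z₁⟩ take one and the same constant value along the whole broken trajectory. (The spherical Kepler–Coulomb billiard whose wall is a circle centered at the center of the problem is integrable.) -/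

import Mathlib

open scoped RealInnerProductSpace

/-- The spherical Kepler–Coulomb energy of the state `(q, v)`. -/
noncomputable def sphericalEnergy (μ : ℝ) (Z q v : EuclideanSpace ℝ (Fin 3)) : ℝ :=
  (1 / 2) * ‖v‖ ^ 2 - μ * ⟪q, Z⟫ * (1 - ⟪q, Z⟫ ^ 2) ^ (-(1 : ℝ) / 2)

/-- The angular momentum of the state `(q, v)` about the axis `Z`. -/
noncomputable def axialMomentum (Z q v : EuclideanSpace ℝ (Fin 3)) : ℝ :=
  ⟪(show EuclideanSpace ℝ (Fin 3) from WithLp.toLp 2 (crossProduct q v)), Z⟫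

theorem axialMomentum_eq (Z q v : EuclideanSpace ℝ (Fin 3)) :
    axialMomentum Z q v = (q 1 * v 2 - q 2 * v 1) * Z 0 + (q 2 * v 0 - q 0 * v 2) * Z 1
      + (q 0 * v 1 - q 1 * v 0) * Z 2 := by
  simp [axialMomentum, PiLp.inner_apply, Fin.sum_univ_three, cross_apply]
  ring

theorem axialMomentum_add_smul_add_smul (Z q v : EuclideanSpace ℝ (Fin 3)) (a b : ℝ) :
    axialMomentum Z q (v + a • q + b • Z) = axialMomentum Z q v := by
  simp only [axialMomentum_eq, PiLp.add_apply, PiLp.smul_apply, smul_eq_mul]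
  ring

theorem hasDerivWithinAt_axialMomentum_add {Z : EuclideanSpace ℝ (Fin 3)}
    {q v : ℝ → EuclideanSpace ℝ (Fin 3)} {q' v' : EuclideanSpace ℝ (Fin 3)} {S : Set ℝ} {s : ℝ}
    (hq : HasDerivWithinAt q q' S s) (hv : HasDerivWithinAt v v' S s) :
    HasDerivWithinAt (fun t ↦ axialMomentum Z (q t) (v t))
      (axialMomentum Z q' (v s) + axialMomentum Z (q s) v') S s := by
  have hq' (i : Fin 3) : HasDerivWithinAt (fun t ↦ q t i) (q' i) S s :=
    (EuclideanSpace.proj (𝕜 := ℝ) i).hasFDerivAt.comp_hasDerivWithinAt s hq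
  have hv' (i : Fin 3) : HasDerivWithinAt (fun t ↦ v t i) (v' i) S s :=
    (EuclideanSpace.proj (𝕜 := ℝ) i).hasFDerivAt.comp_hasDerivWithinAt s hv
  simp only [axialMomentum_eq]
  refine (((((hq' 1).mul (hv' 2)).sub ((hq' 2).mul (hv' 1))).mul_const (Z 0)).add
    ((((hq' 2).mul (hv' 0)).sub ((hq' 0).mul (hv' 2))).mul_const (Z 1)) |>.add
    ((((hq' 0).mul (hv' 1)).sub ((hq' 1).mul (hv' 0))).mul_const (Z 2))).congr_deriv ?_
  ring

theorem axialMomentum_self (Z v : EuclideanSpace ℝ (Fin 3)) : axialMomentum Z v v = 0 := by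
  rw [axialMomentum_eq]; ring

theorem hasDerivAt_mul_one_sub_sq_rpow {c : ℝ} (hc : 0 < 1 - c ^ 2) :
    HasDerivAt (fun x : ℝ ↦ x * (1 - x ^ 2) ^ (-(1 : ℝ) / 2))
      ((1 - c ^ 2) ^ (-(3 : ℝ) / 2)) c := by
  have h := (hasDerivAt_id c).mul
    ((((hasDerivAt_id c).pow 2).const_sub 1).rpow_const (p := -(1 : ℝ) / 2) (Or.inl hc.ne'))
  refine h.congr_deriv ?_
  have h1 : (1 - c ^ 2) ^ (-(1 : ℝ) / 2) = (1 - c ^ 2) ^ (-(3 : ℝ) / 2) * (1 - c ^ 2) := by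
    rw [← Real.rpow_add_one hc.ne']; norm_num
  have h2 : (-(1 : ℝ) / 2 - 1) = -(3 : ℝ) / 2 := by norm_num
  simp only [id, h1, h2, Pi.pow_apply]
  ring

theorem eq_left_of_hasDerivWithinAt_zero {f : ℝ → ℝ} {a b : ℝ} (hab : a < b)
    (hf : ∀ s ∈ Set.Icc a b, HasDerivWithinAt f 0 (Set.Icc a b) s) :
    ∀ s ∈ Set.Icc a b, f s = f a :=
  constant_of_derivWithin_zero (fun s hs ↦ (hf s hs).differentiableWithinAt) fun s hs ↦
    (hf s ⟨hs.1, hs.2.le⟩).derivWithin (uniqueDiffOn_Icc hab s ⟨hs.1, hs.2.le⟩)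

theorem inner_eq_zero_of_norm_eq_one {E : Type*} [NormedAddCommGroup E] [InnerProductSpace ℝ E]
    {q : ℝ → E} {q' : E} {a b s : ℝ} (hab : a < b) (hs : s ∈ Set.Icc a b)
    (hnorm : ∀ t ∈ Set.Icc a b, ‖q t‖ = 1) (hq : HasDerivWithinAt q q' (Set.Icc a b) s) :
    ⟪q s, q'⟫ = 0 := by
  have h := (hasDerivWithinAt_const s (Set.Icc a b) (1 : ℝ)).congr_of_mem
    (f₁ := fun t ↦ ‖q t‖ ^ 2) (fun t ht ↦ by simp [hnorm t ht]) hs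
  have h' := (uniqueDiffOn_Icc hab s hs).eq_deriv _ hq.norm_sq h
  linarith

theorem one_sub_inner_sq_pos {E : Type*} [NormedAddCommGroup E] [InnerProductSpace ℝ E] {x y : E}
    (hx : ‖x‖ = 1) (hy : ‖y‖ = 1) (h : ⟪x, y⟫ ≠ 1 ∧ ⟪x, y⟫ ≠ -1) : 0 < 1 - ⟪x, y⟫ ^ 2 := by
  have habs := abs_le.1 (by simpa [hx, hy] using abs_real_inner_le_norm x y)
  nlinarith [lt_of_le_of_ne habs.2 h.1, lt_of_le_of_ne habs.1 h.2.symm]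

theorem hasDerivWithinAt_sphericalEnergy {μ a b s : ℝ} {Z : EuclideanSpace ℝ (Fin 3)}
    {q v : ℝ → EuclideanSpace ℝ (Fin 3)} (hab : a < b) (hs : s ∈ Set.Icc a b)
    (hnorm : ∀ t ∈ Set.Icc a b, ‖q t‖ = 1) (hpos : 0 < 1 - ⟪q s, Z⟫ ^ 2)
    (hq : HasDerivWithinAt q (v s) (Set.Icc a b) s)
    (hv : HasDerivWithinAt v (-(‖v s‖ ^ 2) • q s +
      (μ * (1 - ⟪q s, Z⟫ ^ 2) ^ (-(3 : ℝ) / 2)) • (Z - ⟪q s, Z⟫ • q s)) (Set.Icc a b) s) :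
    HasDerivWithinAt (fun t ↦ sphericalEnergy μ Z (q t) (v t)) 0 (Set.Icc a b) s := by
  have horth : ⟪v s, q s⟫ = 0 := by
    rw [real_inner_comm]; exact inner_eq_zero_of_norm_eq_one hab hs hnorm hq
  have hc : HasDerivWithinAt (fun t ↦ ⟪q t, Z⟫) ⟪v s, Z⟫ (Set.Icc a b) s := by
    simpa using hq.inner ℝ (hasDerivWithinAt_const s (Set.Icc a b) Z)
  have hpot := (hasDerivAt_mul_one_sub_sq_rpow hpos).comp_hasDerivWithinAt s hc
  have h := (hv.norm_sq.const_mul (1 / 2)).sub (hpot.const_mul μ)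
  simp only [sphericalEnergy, mul_assoc]
  refine h.congr_deriv ?_
  simp only [inner_add_right, inner_sub_right, inner_smul_right, horth]
  ring

theorem hasDerivWithinAt_axialMomentum {Z : EuclideanSpace ℝ (Fin 3)} {s α β γ : ℝ} {S : Set ℝ}
    {q v : ℝ → EuclideanSpace ℝ (Fin 3)} (hq : HasDerivWithinAt q (v s) S s)
    (hv : HasDerivWithinAt v (α • q s + β • (Z - γ • q s)) S s) :
    HasDerivWithinAt (fun t ↦ axialMomentum Z (q t) (v t)) 0 S s := by
  refine (hasDerivWithinAt_axialMomentum_add hq hv).congr_deriv ?_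
  rw [axialMomentum_self, axialMomentum_eq]
  simp only [PiLp.add_apply, PiLp.sub_apply, PiLp.smul_apply, smul_eq_mul]
  ring

theorem norm_sub_two_inner_smul {E : Type*} [NormedAddCommGroup E] [InnerProductSpace ℝ E]
    {n : E} (hn : ‖n‖ = 1) (v : E) : ‖v - (2 * ⟪v, n⟫) • n‖ = ‖v‖ := by
  rw [← sq_eq_sq₀ (norm_nonneg _) (norm_nonneg _), norm_sub_sq_real, norm_smul, hn,
    inner_smul_right, mul_one, Real.norm_eq_abs, sq_abs]
  ring

theorem norm_wall_normal {E : Type*} [NormedAddCommGroup E] [InnerProductSpace ℝ E]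
    {q Z : E} {c : ℝ} (hq : ‖q‖ = 1) (hZ : ‖Z‖ = 1) (hqZ : ⟪q, Z⟫ = c) (hc : 0 < 1 - c ^ 2) :
    ‖(Real.sqrt (1 - c ^ 2))⁻¹ • (Z - c • q)‖ = 1 := by
  have h : ‖Z - c • q‖ ^ 2 = 1 - c ^ 2 := by
    rw [norm_sub_sq_real, norm_smul, hq, hZ, inner_smul_right, real_inner_comm, hqZ, mul_one,
      Real.norm_eq_abs, sq_abs]
    ring
  rw [norm_smul, norm_inv, Real.norm_of_nonneg (Real.sqrt_nonneg _), ← h,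
    Real.sqrt_sq (norm_nonneg _), inv_mul_cancel₀]
  intro h0
  rw [h0] at h
  linarith

/-- The spherical Kepler–Coulomb billiard whose wall is the centered circle
`{q ∈ S² : ⟨q,Z₁⟩ = c₀}` is integrable: along any broken trajectory both the spherical
energy and the axial angular momentum `⟨q × v, Z₁⟩` take one and the same constant
value. -/
theorem spherical_centered_circle_billiard_integrable
    (μ : ℝ) (Z₁ : EuclideanSpace ℝ (Fin 3)) (hZ₁ : ‖Z₁‖ = 1)
    (c₀ : ℝ) (hc₀ : c₀ ∈ Set.Ioo (-1 : ℝ) 1)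
    (n : EuclideanSpace ℝ (Fin 3) → EuclideanSpace ℝ (Fin 3))
    (hn : ∀ p, n p = (Real.sqrt (1 - c₀ ^ 2))⁻¹ • (Z₁ - c₀ • p))
    (N : ℕ) (hN : 0 < N)
    (τ : ℕ → ℝ) (hmono : ∀ i < N, τ i < τ (i + 1))
    (q : ℝ → EuclideanSpace ℝ (Fin 3)) (v w : ℕ → ℝ → EuclideanSpace ℝ (Fin 3))
    (hcont : ContinuousOn q (Set.Icc (τ 0) (τ N)))
    (hsph : ∀ s ∈ Set.Icc (τ 0) (τ N), ‖q s‖ = 1)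
    (hcen : ∀ s ∈ Set.Icc (τ 0) (τ N), ⟪q s, Z₁⟫ ≠ 1 ∧ ⟪q s, Z₁⟫ ≠ -1)
    (hq : ∀ i < N, ∀ s ∈ Set.Icc (τ i) (τ (i + 1)),
      HasDerivWithinAt q (v i s) (Set.Icc (τ i) (τ (i + 1))) s)
    (hv : ∀ i < N, ∀ s ∈ Set.Icc (τ i) (τ (i + 1)),
      HasDerivWithinAt (v i) (w i s) (Set.Icc (τ i) (τ (i + 1))) s)
    (hODE : ∀ i < N, ∀ s ∈ Set.Icc (τ i) (τ (i + 1)),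
      w i s = -(‖v i s‖ ^ 2) • q s +
        (μ * (1 - ⟪q s, Z₁⟫ ^ 2) ^ (-(3 : ℝ) / 2)) • (Z₁ - ⟪q s, Z₁⟫ • q s))
    (hwall : ∀ i, 0 < i → i < N →
      ⟪q (τ i), Z₁⟫ = c₀ ∧
      v i (τ i) = v (i - 1) (τ i) -
        (2 * ⟪v (i - 1) (τ i), n (q (τ i))⟫) • n (q (τ i))) :
    ∃ cE cL : ℝ, ∀ i < N, ∀ s ∈ Set.Icc (τ i) (τ (i + 1)),
      (1 / 2) * ‖v i s‖ ^ 2 -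
          μ * ⟪q s, Z₁⟫ * (1 - ⟪q s, Z₁⟫ ^ 2) ^ (-(1 : ℝ) / 2) = cE ∧
      ⟪(show EuclideanSpace ℝ (Fin 3) from WithLp.toLp 2 (crossProduct (q s) (v i s))), Z₁⟫ = cL := by
  have hτ (j : ℕ) (hj : j ≤ N) : ∀ i ≤ j, τ i ≤ τ j := by
    induction j with
    | zero => intro i hi; simp [Nat.le_zero.1 hi]
    | succ j ih =>
      intro i hi
      rcases Nat.of_le_succ hi with h | rfl
      · exact (ih (by omega) i h).trans (hmono j hj).le
      · exact le_rfl
  have hsub {i : ℕ} (hi : i < N) : Set.Icc (τ i) (τ (i + 1)) ⊆ Set.Icc (τ 0) (τ N) :=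
    Set.Icc_subset_Icc (hτ i hi.le 0 i.zero_le) (hτ N le_rfl (i + 1) hi)
  have hpos {i : ℕ} (hi : i < N) (s : ℝ) (hs : s ∈ Set.Icc (τ i) (τ (i + 1))) :
      0 < 1 - ⟪q s, Z₁⟫ ^ 2 :=
    one_sub_inner_sq_pos (hsph s (hsub hi hs)) hZ₁ (hcen s (hsub hi hs))
  have hE {i : ℕ} (hi : i < N) := eq_left_of_hasDerivWithinAt_zero (hmono i hi) fun s hs ↦
    hasDerivWithinAt_sphericalEnergy (μ := μ) (Z := Z₁) (hmono i hi) hs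
      (fun t ht ↦ hsph t (hsub hi ht)) (hpos hi s hs) (hq i hi s hs)
      (hODE i hi s hs ▸ hv i hi s hs)
  have hL {i : ℕ} (hi : i < N) := eq_left_of_hasDerivWithinAt_zero (hmono i hi) fun s hs ↦
    hasDerivWithinAt_axialMomentum (Z := Z₁) (hq i hi s hs) (hODE i hi s hs ▸ hv i hi s hs)
  have hnode (i : ℕ) (hi : i < N) :
      sphericalEnergy μ Z₁ (q (τ i)) (v i (τ i)) =
        sphericalEnergy μ Z₁ (q (τ 0)) (v 0 (τ 0)) ∧
      axialMomentum Z₁ (q (τ i)) (v i (τ i)) = axialMomentum Z₁ (q (τ 0)) (v 0 (τ 0)) := by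
    induction i with
    | zero => exact ⟨rfl, rfl⟩
    | succ i ih =>
      have hi' : i < N := by omega
      have hmem : τ (i + 1) ∈ Set.Icc (τ i) (τ (i + 1)) := Set.right_mem_Icc.2 (hmono i hi').le
      obtain ⟨hw, hr⟩ := hwall (i + 1) i.succ_pos hi
      rw [Nat.add_sub_cancel] at hr
      obtain ⟨ihE, ihL⟩ := ih hi'
      rw [← ihE, ← ihL, ← hE hi' _ hmem, ← hL hi' _ hmem]
      constructor
      · have hnorm : ‖n (q (τ (i + 1)))‖ = 1 := by
          rw [hn]
          exact norm_wall_normal (hsph _ (hsub hi' hmem)) hZ₁ hw (by nlinarith [hc₀.1, hc₀.2])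
        rw [sphericalEnergy, sphericalEnergy, hr, norm_sub_two_inner_smul hnorm]
      · rw [hr]
        generalize 2 * ⟪v i (τ (i + 1)), n (q (τ (i + 1)))⟫ = k
        rw [← axialMomentum_add_smul_add_smul Z₁ _ (v i (τ (i + 1)))
          (k * (Real.sqrt (1 - c₀ ^ 2))⁻¹ * c₀) (-(k * (Real.sqrt (1 - c₀ ^ 2))⁻¹)), hn]
        congr 1
        module
  exact ⟨_, _, fun i hi s hs ↦
    ⟨(hE hi s hs).trans (hnode i hi).1, (hL hi s hs).trans (hnode i hi).2⟩⟩
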